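/- Let K be a field, d ≥ 1, and r ≥ 1. Let p₁,…,p_r ∈ K^{d+1} be points lying in the hyperplane x₀ = 0 (p_j(0) = 0) with each p_j ≠ 0, let q₁,…,q_r ∈ K^d be their truncations, and let m₁,…,m_r be nonnegative integers. Then in R' = K[x₀,x₁,…,x_d] one has ⋂_{j=1}^r P'(p_j)^{m_j} = (x₀) · ( ⋂_{j=1}^r P'(p_j)^{(m_j − 1)₊} ) + Ideal.map ι ( ⋂_{j=1}^r P(q_j)^{m_j} ), where (x₀) is the principal ideal generated by x₀ and n₊ = max{n,0}. -/

import Mathlib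

open MvPolynomial

/-- The ideal of a point `p ∈ Kⁿ`: generated by the homogeneous linear forms
vanishing at `p`. -/
noncomputable def pointIdeal {K : Type} [Field K] {n : ℕ} (p : Fin n → K) :
    Ideal (MvPolynomial (Fin n) K) :=
  Ideal.span {ℓ : MvPolynomial (Fin n) K | ℓ.IsHomogeneous 1 ∧ eval p ℓ = 0}

/-- Membership in a power of the ideal `(X) + I[X]` of `A[X]` is detected coefficientwise. -/
theorem mem_span_X_sup_map_C_pow_iff {A : Type*} [CommRing A] (I : Ideal A) (m : ℕ)
    (f : Polynomial A) :
    f ∈ (Ideal.span {(Polynomial.X : Polynomial A)} ⊔ I.map Polynomial.C) ^ m ↔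
      ∀ i, f.coeff i ∈ I ^ (m - i) := by
  set J := Ideal.span {(Polynomial.X : Polynomial A)} ⊔ I.map Polynomial.C with hJ
  have coeff_zero_mem : ∀ b ∈ J, b.coeff 0 ∈ I := by
    have h : J ≤ I.comap Polynomial.constantCoeff := by
      refine sup_le ?_ (Ideal.map_le_iff_le_comap.2 fun a ha => ?_)
      · simp [Ideal.span_le]
      · simpa using ha
    exact fun b hb => h hb
  constructor
  · intro hf
    induction m generalizing f with
    | zero => simp
    | succ m ih =>
      rw [pow_succ] at hf
      refine Submodule.mul_induction_on hf (fun a ha b hb i => ?_) fun a b ha hb i => ?_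
      · rw [Polynomial.coeff_mul]
        refine Ideal.sum_mem _ fun x hx => ?_
        have hx' := Finset.HasAntidiagonal.mem_antidiagonal.1 hx
        have hb' : b.coeff x.2 ∈ I ^ (1 - x.2) := by
          rcases Nat.eq_zero_or_pos x.2 with h | h
          · simpa [h] using coeff_zero_mem b hb
          · simp [Nat.sub_eq_zero_of_le h]
        have h := Ideal.mul_mem_mul (ih a ha x.1) hb'
        rw [← pow_add] at h
        exact Ideal.pow_le_pow_right (by omega) h
      · rw [Polynomial.coeff_add]
        exact Ideal.add_mem _ (ha i) (hb i)
  · intro hf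
    rw [f.as_sum_support_C_mul_X_pow]
    refine Ideal.sum_mem _ fun i _ => ?_
    have hC : Polynomial.C (f.coeff i) ∈ J ^ (m - i) := by
      refine Ideal.pow_right_mono (le_sup_right : I.map Polynomial.C ≤ J) _ ?_
      rw [← Ideal.map_pow]
      exact Ideal.mem_map_of_mem _ (hf i)
    have hX : (Polynomial.X : Polynomial A) ^ i ∈ J ^ i :=
      Ideal.pow_mem_pow (le_sup_left (a := Ideal.span {(Polynomial.X : Polynomial A)})
        (Ideal.mem_span_singleton_self _)) i
    have h := Ideal.mul_mem_mul hC hX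
    rw [← pow_add] at h
    exact Ideal.pow_le_pow_right (by omega) h

theorem finSuccEquiv_rename_succ {K : Type} [Field K] {d : ℕ} (g : MvPolynomial (Fin d) K) :
    MvPolynomial.finSuccEquiv K d (rename Fin.succ g) = Polynomial.C g := by
  induction g using MvPolynomial.induction_on with
  | C a => simp [finSuccEquiv_apply]
  | add f g hf hg => rw [map_add, map_add, hf, hg, map_add]
  | mul_X f i hf => rw [map_mul, map_mul, hf, rename_X, finSuccEquiv_X_succ, map_mul]

/-- Separating the first variable of a multivariate polynomial. -/
theorem X_zero_mul_add_rename_succ {K : Type} [Field K] {d : ℕ}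
    (f : MvPolynomial (Fin (d + 1)) K) :
    X 0 * (MvPolynomial.finSuccEquiv K d).symm (MvPolynomial.finSuccEquiv K d f).divX +
      rename Fin.succ ((MvPolynomial.finSuccEquiv K d f).coeff 0) = f := by
  apply (MvPolynomial.finSuccEquiv K d).injective
  rw [map_add, map_mul, finSuccEquiv_X_zero, AlgEquiv.apply_symm_apply, finSuccEquiv_rename_succ]
  rw [mul_comm, Polynomial.divX_mul_X_add]

theorem pointIdeal_eq_span_X_zero_sup_map {K : Type} [Field K] {d : ℕ}
    (p : Fin (d + 1) → K) (hp : p 0 = 0) :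
    pointIdeal p = Ideal.span {(X 0 : MvPolynomial (Fin (d + 1)) K)} ⊔
      (pointIdeal fun i => p i.succ).map (rename (Fin.succ : Fin d → Fin (d + 1))) := by
  apply le_antisymm
  · refine Ideal.span_le.2 fun ℓ ⟨hℓ, hℓp⟩ => ?_
    have hmem : (MvPolynomial.finSuccEquiv K d ℓ).coeff 0 ∈ pointIdeal fun i => p i.succ := by
      refine Ideal.subset_span ⟨hℓ.finSuccEquiv_coeff_isHomogeneous 0 1 (by simp), ?_⟩
      have h := congrArg (eval p) (X_zero_mul_add_rename_succ ℓ)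
      simpa [hp, hℓp, eval_rename, Function.comp_def] using h
    rw [← X_zero_mul_add_rename_succ ℓ]
    exact Ideal.add_mem _
      (Ideal.mem_sup_left (Ideal.mul_mem_right _ _ (Ideal.mem_span_singleton_self _)))
      (Ideal.mem_sup_right (Ideal.mem_map_of_mem _ hmem))
  · refine sup_le (Ideal.span_le.2 ?_) ?_
    · rw [Set.singleton_subset_iff]
      exact Ideal.subset_span ⟨isHomogeneous_X _ _, by simpa using hp⟩
    · refine Ideal.map_le_iff_le_comap.2 (Ideal.span_le.2 fun ℓ ⟨hℓ, hℓp⟩ => ?_)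
      refine Ideal.subset_span ⟨hℓ.rename_isHomogeneous, ?_⟩
      simpa [eval_rename, Function.comp_def] using hℓp

theorem mem_pointIdeal_pow_iff {K : Type} [Field K] {d : ℕ} (p : Fin (d + 1) → K)
    (hp : p 0 = 0) (m : ℕ) (f : MvPolynomial (Fin (d + 1)) K) :
    f ∈ pointIdeal p ^ m ↔
      ∀ i, (MvPolynomial.finSuccEquiv K d f).coeff i ∈ (pointIdeal fun i => p i.succ) ^ (m - i) := by
  have hmap : (pointIdeal p).map (MvPolynomial.finSuccEquiv K d) =
      Ideal.span {Polynomial.X} ⊔ (pointIdeal fun i => p i.succ).map Polynomial.C := by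
    have hcomp : ((MvPolynomial.finSuccEquiv K d).toRingEquiv.toRingHom.comp
        (rename (R := K) (Fin.succ : Fin d → Fin (d + 1))).toRingHom) = Polynomial.C :=
      RingHom.ext finSuccEquiv_rename_succ
    rw [pointIdeal_eq_span_X_zero_sup_map p hp, Ideal.map_sup, Ideal.map_span,
      Set.image_singleton, finSuccEquiv_X_zero, ← hcomp, ← Ideal.map_map]
    rfl
  rw [← mem_span_X_sup_map_C_pow_iff, ← hmap, ← Ideal.map_pow, Ideal.mem_map_of_equiv]
  simp

/-- For a fat point ideal with support in the hyperplane `x₀ = 0`: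
`⋂ⱼ P'(pⱼ)^{mⱼ} = (x₀)⋅(⋂ⱼ P'(pⱼ)^{(mⱼ−1)₊}) + ι(⋂ⱼ P(qⱼ)^{mⱼ})`. -/
theorem fat_point_ideal_eq_x0_mul_add_map
    {K : Type} [Field K] (d r : ℕ) (hd : 1 ≤ d) (hr : 1 ≤ r)
    (p : Fin r → Fin (d + 1) → K)
    (hp0 : ∀ j, p j 0 = 0) (hpne : ∀ j, p j ≠ 0)
    (m : Fin r → ℕ) :
    (⨅ j, pointIdeal (p j) ^ m j) =
      Ideal.span {(X 0 : MvPolynomial (Fin (d + 1)) K)} *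
          (⨅ j, pointIdeal (p j) ^ (m j - 1)) +
        Ideal.map (rename (Fin.succ : Fin d → Fin (d + 1)))
          (⨅ j, pointIdeal (fun i => p j i.succ) ^ m j) := by
  apply le_antisymm
  · intro f hf
    have hcoeff := fun j => (mem_pointIdeal_pow_iff (p j) (hp0 j) (m j) f).1 (Ideal.mem_iInf.1 hf j)
    rw [← X_zero_mul_add_rename_succ f]
    refine Submodule.add_mem_sup
      (Ideal.mul_mem_mul (Ideal.mem_span_singleton_self _) (Ideal.mem_iInf.2 fun j => ?_))
      (Ideal.mem_map_of_mem _ (Ideal.mem_iInf.2 fun j => hcoeff j 0))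
    rw [mem_pointIdeal_pow_iff (p j) (hp0 j)]
    intro i
    rw [AlgEquiv.apply_symm_apply, Polynomial.coeff_divX, Nat.sub_sub, add_comm 1 i]
    exact hcoeff j (i + 1)
  · refine sup_le (le_iInf fun j => ?_) (le_iInf fun j => ?_)
    · have hX : Ideal.span {(X 0 : MvPolynomial (Fin (d + 1)) K)} ≤ pointIdeal (p j) := by
        rw [pointIdeal_eq_span_X_zero_sup_map (p j) (hp0 j)]
        exact le_sup_left
      calc _ ≤ pointIdeal (p j) * pointIdeal (p j) ^ (m j - 1) :=
            Ideal.mul_mono hX (iInf_le _ j)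
        _ = pointIdeal (p j) ^ (m j - 1 + 1) := (pow_succ' _ _).symm
        _ ≤ pointIdeal (p j) ^ m j := Ideal.pow_le_pow_right (by omega)
    · refine (Ideal.map_mono (iInf_le _ j)).trans ?_
      rw [Ideal.map_pow, pointIdeal_eq_span_X_zero_sup_map (p j) (hp0 j)]
      exact Ideal.pow_right_mono le_sup_right _
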